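/- arXiv:2101.03191 — 2 statements merged into one kernel-verified Lean document; each statement's English description precedes it below -/
import Mathlib

section
/- Let h be a Hessenberg function on {1,…,n} and μ = (μ_1,…,μ_ℓ) a composition of n. Then the top-coset class f_μ satisfies the GKM conditions for h: for every w ∈ S_n and every pair i > j with w(i) < w(j) and i ≤ h(j), the polynomial t_{w(i)} − t_{w(j)} divides f_μ(w) − f_μ(w τ_{ij}) in R. Moreover, y · f_μ = f_μ for every y ∈ S_μ, where · denotes the dot action. -/
open MvPolynomial Finset

/-- Partial sums of a composition: `psum μ i = μ 0 + ⋯ + μ (i-1)` (so `psum μ i = [μ]_i`). -/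
def psum (μ : ℕ → ℕ) (i : ℕ) : ℕ := ∑ t ∈ Finset.range i, μ t

/-- Membership in the Young subgroup `S_μ` (0-based): `y` maps each block
`{psum μ b, …, psum μ (b+1) - 1}` (for `b < L`) to itself. -/
def YoungC {n : ℕ} (μ : ℕ → ℕ) (L : ℕ) (y : Equiv.Perm (Fin n)) : Prop :=
  ∀ b, b < L → ∀ p : Fin n, psum μ b ≤ (p : ℕ) → (p : ℕ) < psum μ (b + 1) →
    psum μ b ≤ (y p : ℕ) ∧ (y p : ℕ) < psum μ (b + 1)

/-- `v` is the permutation `v_μ`, defined (1-based) by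
`v_μ([μ']_{ℓ-i-1} + j) = [μ]_i + j` for `0 ≤ i ≤ ℓ-1`, `1 ≤ j ≤ μ_{i+1}`,
written with 0-based indices. -/
def IsVmu {n : ℕ} (μ : ℕ → ℕ) (L : ℕ) (v : Equiv.Perm (Fin n)) : Prop :=
  ∀ i, i < L → ∀ j, j < μ i →
    ∀ (hp : psum (fun t => μ (L - 1 - t)) (L - 1 - i) + j < n) (hq : psum μ i + j < n),
      v ⟨psum (fun t => μ (L - 1 - t)) (L - 1 - i) + j, hp⟩ = ⟨psum μ i + j, hq⟩

/-- The set `N_h^-(v) = {(i,j) : j < i, v(i) < v(j), i ≤ h(j)}`. -/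
def NhSet {n : ℕ} (h : Fin n → Fin n) (v : Equiv.Perm (Fin n)) : Finset (Fin n × Fin n) :=
  Finset.univ.filter fun p => p.2 < p.1 ∧ v p.1 < v p.2 ∧ p.1 ≤ h p.2

/- The top-coset class `f_μ`:  `f_μ(w) = ∏_{(i,j) ∈ N_h^-(v_μ)} (t_{w(i)} - t_{w(j)})` if
`w ∈ S_μ v_μ`, and `f_μ(w) = 0` otherwise. -/
open Classical in
noncomputable def topClass {n : ℕ} (h : Fin n → Fin n) (μ : ℕ → ℕ) (L : ℕ)
    (vmu : Equiv.Perm (Fin n)) : Equiv.Perm (Fin n) → MvPolynomial (Fin n) ℂ :=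
  fun w =>
    if ∃ y, YoungC μ L y ∧ w = y * vmu then
      ∏ p ∈ NhSet h vmu, (X (w p.1) - X (w p.2))
    else 0

/-- The dot action `(v · f)(w) = v(f(v⁻¹ w))`. -/
noncomputable def dot {n : ℕ} (v : Equiv.Perm (Fin n))
    (f : Equiv.Perm (Fin n) → MvPolynomial (Fin n) ℂ) :
    Equiv.Perm (Fin n) → MvPolynomial (Fin n) ℂ :=
  fun w => rename (⇑v) (f (v⁻¹ * w))

/-- `v ∈ S_n^μ`, the shortest left coset representatives of `S_n / S_μ`:
`v(p) < v(p+1)` whenever `p+1` is not one of the partial sums `[μ]_b`, `b < L`. -/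
def ShortLeftC {n : ℕ} (μ : ℕ → ℕ) (L : ℕ) (v : Equiv.Perm (Fin n)) : Prop :=
  ∀ p q : Fin n, (p : ℕ) + 1 = (q : ℕ) → (∀ b, b < L → (q : ℕ) ≠ psum μ b) → v p < v q

/-- `v ∈ ^μS_n`, the shortest right coset representatives of `S_μ \ S_n`:
`v⁻¹(p) < v⁻¹(p+1)` whenever `p+1` is not one of the partial sums `[μ]_b`, `b < L`. -/
def ShortRightC {n : ℕ} (μ : ℕ → ℕ) (L : ℕ) (v : Equiv.Perm (Fin n)) : Prop :=
  ∀ p q : Fin n, (p : ℕ) + 1 = (q : ℕ) → (∀ b, b < L → (q : ℕ) ≠ psum μ b) → v⁻¹ p < v⁻¹ q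

theorem psum_mono (μ : ℕ → ℕ) : Monotone (psum μ) := fun _ _ hab =>
  Finset.sum_le_sum_of_subset (Finset.range_mono hab)

theorem psum_succ (μ : ℕ → ℕ) (b : ℕ) : psum μ (b + 1) = psum μ b + μ b :=
  Finset.sum_range_succ _ _

theorem psum_reverse (μ : ℕ → ℕ) (L : ℕ) : psum (fun t => μ (L - 1 - t)) L = psum μ L :=
  Finset.sum_range_reflect μ L

/-- `p` lies in the `b`-th block of the composition `μ`. -/
def InBlock (μ : ℕ → ℕ) (b p : ℕ) : Prop := psum μ b ≤ p ∧ p < psum μ (b + 1)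

theorem exists_inBlock (μ : ℕ → ℕ) (L p : ℕ) (hp : p < psum μ L) :
    ∃ b, b < L ∧ InBlock μ b p := by
  induction L with
  | zero => simp [_root_.psum] at hp
  | succ L ih =>
    by_cases hL : p < psum μ L
    · obtain ⟨b, hb, hb'⟩ := ih hL
      exact ⟨b, by omega, hb'⟩
    · exact ⟨L, by omega, by omega, hp⟩

theorem InBlock.index_le {μ : ℕ → ℕ} {b c p q : ℕ} (hp : InBlock μ b p) (hq : InBlock μ c q)
    (hpq : p ≤ q) : b ≤ c := by
  by_contra! hcb
  have := psum_mono μ (Nat.succ_le_of_lt hcb)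
  have := hp.1
  have := hq.2
  simp only [Nat.succ_eq_add_one] at *
  omega

theorem InBlock.index_unique {μ : ℕ → ℕ} {b c p : ℕ} (hb : InBlock μ b p) (hc : InBlock μ c p) :
    b = c :=
  le_antisymm (hb.index_le hc le_rfl) (hc.index_le hb le_rfl)

section Young

variable {n : ℕ} {μ : ℕ → ℕ} {L : ℕ}

theorem YoungC.inBlock {y : Equiv.Perm (Fin n)} (hy : YoungC μ L y) {b : ℕ} (hb : b < L)
    {p : Fin n} (hp : InBlock μ b p) : InBlock μ b (y p) :=
  hy b hb p hp.1 hp.2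

theorem YoungC.mul {y z : Equiv.Perm (Fin n)} (hy : YoungC μ L y) (hz : YoungC μ L z) :
    YoungC μ L (y * z) :=
  fun _ hb _ h₁ h₂ => hy.inBlock hb (hz.inBlock hb ⟨h₁, h₂⟩)

theorem YoungC.inv (htot : psum μ L = n) {y : Equiv.Perm (Fin n)} (hy : YoungC μ L y) :
    YoungC μ L y⁻¹ := by
  intro b hb p h₁ h₂
  obtain ⟨c, hc, hcp⟩ := exists_inBlock μ L (y⁻¹ p : Fin n) (by omega)
  have hp : InBlock μ c p := by simpa using hy.inBlock hc hcp
  rwa [hp.index_unique ⟨h₁, h₂⟩] at hcp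

theorem youngC_swap {b : ℕ} {p q : Fin n} (hp : InBlock μ b p) (hq : InBlock μ b q) :
    YoungC μ L (Equiv.swap p q) := by
  intro c _ r h₁ h₂
  have hr : InBlock μ c r := ⟨h₁, h₂⟩
  change InBlock μ c _
  rcases eq_or_ne r p with rfl | hrp
  · rwa [Equiv.swap_apply_left, hr.index_unique hp]
  rcases eq_or_ne r q with rfl | hrq
  · rwa [Equiv.swap_apply_right, hr.index_unique hq]
  · rwa [Equiv.swap_apply_of_ne_of_ne hrp hrq]

/-- `w` lies in the coset `S_μ v`. -/
def InCoset (μ : ℕ → ℕ) (L : ℕ) (v w : Equiv.Perm (Fin n)) : Prop :=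
  ∃ y, YoungC μ L y ∧ w = y * v

theorem InCoset.mul_left {v w y : Equiv.Perm (Fin n)} (hy : YoungC μ L y)
    (hw : InCoset μ L v w) : InCoset μ L v (y * w) := by
  obtain ⟨z, hz, rfl⟩ := hw
  exact ⟨y * z, hy.mul hz, (mul_assoc _ _ _).symm⟩

theorem InCoset.mul_swap {v w : Equiv.Perm (Fin n)} (hw : InCoset μ L v w) {b : ℕ}
    {i j : Fin n} (hi : InBlock μ b (w i)) (hj : InBlock μ b (w j)) :
    InCoset μ L v (w * Equiv.swap i j) := by
  rw [Equiv.mul_swap_eq_swap_mul]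
  exact hw.mul_left (youngC_swap hi hj)

/-- All elements of `S_μ v` send a given position to the same block. -/
theorem InCoset.exists_inBlock (htot : psum μ L = n) {v w : Equiv.Perm (Fin n)}
    (hw : InCoset μ L v w) (p : Fin n) : ∃ b, InBlock μ b (v p) ∧ InBlock μ b (w p) := by
  obtain ⟨y, hy, rfl⟩ := hw
  obtain ⟨b, hb, hbp⟩ := _root_.exists_inBlock μ L (v p) (by omega)
  exact ⟨b, hbp, hy.inBlock hb hbp⟩

/-- `v_μ` sends the `k`-th block of the reversed composition to the block `L - 1 - k` of `μ`. -/
theorem IsVmu.inBlock (htot : psum μ L = n) {v : Equiv.Perm (Fin n)} (hv : IsVmu μ L v)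
    {k : ℕ} (hk : k < L) {p : Fin n} (hp : InBlock (fun t => μ (L - 1 - t)) k p) :
    InBlock μ (L - 1 - k) (v p) := by
  obtain ⟨h₁, h₂⟩ := hp
  rw [psum_succ] at h₂
  obtain ⟨j, hj⟩ := Nat.exists_eq_add_of_le h₁
  have hk' : L - 1 - (L - 1 - k) = k := by omega
  have hj' : j < μ (L - 1 - k) := by omega
  have hle := psum_mono μ (show L - 1 - k + 1 ≤ L by omega)
  have hs := psum_succ μ (L - 1 - k)
  have hvj := hv (L - 1 - k) (by omega) j hj' (by rw [hk']; omega) (by omega)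
  have hpj : p = ⟨psum (fun t => μ (L - 1 - t)) (L - 1 - (L - 1 - k)) + j,
      by rw [hk']; omega⟩ := Fin.ext (by simp only [hk']; exact hj)
  rw [hpj, hvj]
  exact ⟨by simp, by simp only; omega⟩

/-- `v_μ` reverses the order of the blocks. -/
theorem IsVmu.index_le (htot : psum μ L = n) {v : Equiv.Perm (Fin n)} (hv : IsVmu μ L v)
    {i j : Fin n} (hji : j < i) {b c : ℕ} (hb : InBlock μ b (v i)) (hc : InBlock μ c (v j)) :
    b ≤ c := by
  have htot' := psum_reverse μ L
  obtain ⟨k, hk, hki⟩ := exists_inBlock (fun t => μ (L - 1 - t)) L i (by omega)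
  obtain ⟨m, hm, hmj⟩ := exists_inBlock (fun t => μ (L - 1 - t)) L j (by omega)
  have hmk := hmj.index_le hki hji.le
  rw [hb.index_unique (hv.inBlock htot hk hki), hc.index_unique (hv.inBlock htot hm hmj)]
  omega

end Young

theorem dvd_prod_sub_prod_of_dvd_sub {ι R : Type*} [CommRing R] (d : R) (s : Finset ι)
    (f g : ι → R) (hfg : ∀ i ∈ s, d ∣ f i - g i) : d ∣ ∏ i ∈ s, f i - ∏ i ∈ s, g i := by
  simp only [← Ideal.mem_span_singleton, ← Ideal.Quotient.eq, map_prod] at hfg ⊢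
  exact Finset.prod_congr rfl hfg

theorem X_sub_X_dvd_swap {n : ℕ} (w : Equiv.Perm (Fin n)) (i j k : Fin n) :
    (X (w i) - X (w j) : MvPolynomial (Fin n) ℂ) ∣
      X (w k) - X ((w * Equiv.swap i j) k) := by
  rw [Equiv.Perm.mul_apply]
  rcases eq_or_ne k i with rfl | hki
  · simp
  rcases eq_or_ne k j with rfl | hkj
  · rw [Equiv.swap_apply_right, dvd_sub_comm]
  · simp [Equiv.swap_apply_of_ne_of_ne hki hkj]

section TopClass

variable {n : ℕ} {h : Fin n → Fin n} {μ : ℕ → ℕ} {L : ℕ} {v w : Equiv.Perm (Fin n)}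

theorem topClass_of_inCoset (hw : InCoset μ L v w) :
    topClass h μ L v w = ∏ p ∈ NhSet h v, (X (w p.1) - X (w p.2)) :=
  if_pos hw

theorem topClass_of_not_inCoset (hw : ¬ InCoset μ L v w) : topClass h μ L v w = 0 :=
  if_neg hw

/-- The top-coset class satisfies the GKM conditions. -/
theorem topClass_dvd_sub (htot : psum μ L = n) (hv : IsVmu μ L v) {i j : Fin n} (hji : j < i)
    (hwij : w i < w j) (hih : i ≤ h j) :
    (X (w i) - X (w j) : MvPolynomial (Fin n) ℂ) ∣
      topClass h μ L v w - topClass h μ L v (w * Equiv.swap i j) := by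
  by_cases hw : InCoset μ L v w
  · by_cases hws : InCoset μ L v (w * Equiv.swap i j)
    · rw [topClass_of_inCoset hw, topClass_of_inCoset hws]
      refine dvd_prod_sub_prod_of_dvd_sub _ _ _ _ fun p _ => ?_
      rw [sub_sub_sub_comm]
      exact dvd_sub (X_sub_X_dvd_swap w i j p.1) (X_sub_X_dvd_swap w i j p.2)
    · rw [topClass_of_inCoset hw, topClass_of_not_inCoset hws, sub_zero]
      obtain ⟨b, hvi, hwi⟩ := hw.exists_inBlock htot i
      obtain ⟨c, hvj, hwj⟩ := hw.exists_inBlock htot j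
      have hvij : v i < v j := by
        by_contra! hle
        have hbc := le_antisymm (hwi.index_le hwj hwij.le) (hvj.index_le hvi hle)
        exact hws (hw.mul_swap hwi (hbc ▸ hwj))
      have hmem : (i, j) ∈ NhSet h v := by simp [NhSet, hji, hvij, hih]
      simpa only using Finset.dvd_prod_of_mem (fun p : Fin n × Fin n =>
        (X (w p.1) - X (w p.2) : MvPolynomial (Fin n) ℂ)) hmem
  · by_cases hws : InCoset μ L v (w * Equiv.swap i j)
    · obtain ⟨b, hvi, hwi⟩ := hws.exists_inBlock htot i
      obtain ⟨c, hvj, hwj⟩ := hws.exists_inBlock htot j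
      have hcb : c ≤ b := hwj.index_le hwi (by simpa using hwij.le)
      have hbc := le_antisymm (hv.index_le htot hji hvi hvj) hcb
      have hw' := hws.mul_swap hwi (hbc ▸ hwj)
      rw [Equiv.mul_swap_mul_self] at hw'
      exact absurd hw' hw
    · simp [topClass_of_not_inCoset hw, topClass_of_not_inCoset hws]

/-- The top-coset class is invariant under the dot action of the Young subgroup. -/
theorem dot_topClass (htot : psum μ L = n) {y : Equiv.Perm (Fin n)} (hy : YoungC μ L y) :
    dot y (topClass h μ L v) = topClass h μ L v := by
  funext w
  by_cases hw : InCoset μ L v w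
  · simp [dot, topClass_of_inCoset hw, topClass_of_inCoset (hw.mul_left (hy.inv htot))]
  · have hyw : ¬ InCoset μ L v (y⁻¹ * w) := fun hyw => hw (by simpa using hyw.mul_left hy)
    simp [dot, topClass_of_not_inCoset hw, topClass_of_not_inCoset hyw]

end TopClass

/-- Proposition 3.2 / `prop: top coset class`: the top-coset class `f_μ`
satisfies the GKM conditions for `h`, and is fixed by `S_μ` under the dot action. -/
theorem statement4 (n : ℕ) (h : Fin n → Fin n) (hmono : Monotone h) (hgrow : ∀ i, i ≤ h i)
    (μ : ℕ → ℕ) (L : ℕ) (hpos : ∀ i, i < L → 0 < μ i) (htot : psum μ L = n)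
    (vmu : Equiv.Perm (Fin n)) (hvmu : IsVmu μ L vmu) :
    (∀ w : Equiv.Perm (Fin n), ∀ i j : Fin n, j < i → w i < w j → i ≤ h j →
      (X (w i) - X (w j) : MvPolynomial (Fin n) ℂ) ∣
        topClass h μ L vmu w - topClass h μ L vmu (w * Equiv.swap i j)) ∧
    (∀ y : Equiv.Perm (Fin n), YoungC μ L y →
      dot y (topClass h μ L vmu) = topClass h μ L vmu) :=
  ⟨fun _ _ _ hji hwij hih => topClass_dvd_sub htot hvmu hji hwij hih,
    fun _ hy => dot_topClass htot hy⟩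
end

section
/- Let h be a Hessenberg function on {1,…,n}, λ = (λ_1, λ_2) a composition of n with two positive parts, and set k = λ_2 − 1. For a λ_1-element subset J ⊆ {1,…,n} write supp(v_J · f_λ^{(k)}) = {w ∈ S_n : (v_J · f_λ^{(k)})(w) ≠ 0}. Then: (1) for λ_1-element subsets I, J of {1,…,n}, supp(v_J · f_λ^{(k)}) ∩ supp(v_I · f_λ^{(k)}) ≠ ∅ if and only if I = J or |I ∩ J| = λ_1 − 1; and (2) if I, J, K are pairwise distinct λ_1-element subsets of {1,…,n}, then supp(v_J · f_λ^{(k)}) ∩ supp(v_I · f_λ^{(k)}) ∩ supp(v_K · f_λ^{(k)}) = ∅. -/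
open MvPolynomial Finset

/-- Membership in the Young subgroup `S_λ` for a two-part composition `λ = (l1, n - l1)`,
written with 0-based indices: `y` maps `{0, …, l1 - 1}` to itself. -/
def YoungTwo {n : ℕ} (l1 : ℕ) (y : Equiv.Perm (Fin n)) : Prop :=
  ∀ i : Fin n, (y i : ℕ) < l1 ↔ (i : ℕ) < l1

/-- `v` is the permutation whose (1-based) one-line notation is
`[l1+1, l1+2, …, l1+k, 1, l1+k+1, …, n, 2, 3, …, l1]`, written with 0-based indices. -/
def IsVk {n : ℕ} (l1 l2 k : ℕ) (v : Equiv.Perm (Fin n)) : Prop :=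
  ∀ p : Fin n, (v p : ℕ) =
    if (p : ℕ) < k then l1 + (p : ℕ)
    else if (p : ℕ) = k then 0
    else if (p : ℕ) ≤ l2 then l1 + (p : ℕ) - 1
    else (p : ℕ) - l2

/-- The set `𝒮_k = {(a,b) : a < b, v_k⁻¹(a) > v_k⁻¹(b), v_k⁻¹(a) ≤ h(v_k⁻¹(b))}`. -/
def SkSet {n : ℕ} (h : Fin n → Fin n) (vk : Equiv.Perm (Fin n)) :
    Finset (Fin n × Fin n) :=
  Finset.univ.filter fun p =>
    p.1 < p.2 ∧ vk⁻¹ p.2 < vk⁻¹ p.1 ∧ vk⁻¹ p.1 ≤ h (vk⁻¹ p.2)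

/-- `v` is the shortest left coset representative `v_J`: it lists the elements of `J`
increasingly on the first `l1` (0-based) positions, then the complement increasingly. -/
def IsVJ {n : ℕ} (l1 : ℕ) (J : Finset (Fin n)) (v : Equiv.Perm (Fin n)) : Prop :=
  (∀ p : Fin n, v p ∈ J ↔ (p : ℕ) < l1) ∧
  (∀ p q : Fin n, p < q → (q : ℕ) < l1 → v p < v q) ∧
  (∀ p q : Fin n, p < q → l1 ≤ (p : ℕ) → v p < v q)

/-- An element of the coset `S_λ v_j` is recognised by the positions
at which it takes values below `l1`. -/
lemma youngTwo_mul_inv_iff {n l1 l2 j : ℕ} (hl1 : 0 < l1) (hsum : l1 + l2 = n) (hj : j ≤ l2)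
    {v : Equiv.Perm (Fin n)} (hv : IsVk l1 l2 j v) (u : Equiv.Perm (Fin n)) :
    YoungTwo l1 (u * v⁻¹) ↔ ∀ p : Fin n, (u p : ℕ) < l1 ↔ ((p : ℕ) = j ∨ l2 < (p : ℕ)) := by
  have key : ∀ p : Fin n, (v p : ℕ) < l1 ↔ ((p : ℕ) = j ∨ l2 < (p : ℕ)) := by
    intro p
    have hp := p.isLt
    rw [hv p]
    split_ifs <;> omega
  constructor
  · intro hy p
    rw [← key p]
    simpa using hy (v p)
  · intro hu i
    have hi := (hu (v⁻¹ i)).trans (key (v⁻¹ i)).symm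
    simpa using hi

lemma prod_X_sub_X_ne_zero {n : ℕ} (h : Fin n → Fin n) (w y : Equiv.Perm (Fin n)) :
    ∏ p ∈ SkSet h w, (X (y p.1) - X (y p.2) : MvPolynomial (Fin n) ℂ) ≠ 0 := by
  refine Finset.prod_ne_zero_iff.2 fun p hp => sub_ne_zero.2 fun e => ?_
  have hlt : p.1 < p.2 := (Finset.mem_filter.1 hp).2.1
  exact hlt.ne (y.injective (X_injective e))

/-- `w` lies in the support of `v_J · f` iff `w` carries one of the position sets
`{j} ∪ {l2 + 1, …}` with `k ≤ j ≤ l2` onto `J`. -/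
lemma dot_ne_zero_iff {n : ℕ} (h : Fin n → Fin n) {l1 l2 k : ℕ} (hl1 : 0 < l1)
    (hsum : l1 + l2 = n)
    {v : ℕ → Equiv.Perm (Fin n)} (hv : ∀ j ≤ l2, IsVk l1 l2 j (v j))
    {f : Equiv.Perm (Fin n) → MvPolynomial (Fin n) ℂ}
    (hfval : ∀ j, k ≤ j → j ≤ l2 → ∀ y : Equiv.Perm (Fin n), YoungTwo l1 y →
      f (y * v j) = ∏ p ∈ SkSet h (v k), (X (y p.1) - X (y p.2)))
    (hfzero : ∀ w : Equiv.Perm (Fin n),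
      (¬ ∃ j, k ≤ j ∧ j ≤ l2 ∧ ∃ y : Equiv.Perm (Fin n), YoungTwo l1 y ∧ w = y * v j) →
      f w = 0)
    {J : Finset (Fin n)} {x : Equiv.Perm (Fin n)} (hx : IsVJ l1 J x) (w : Equiv.Perm (Fin n)) :
    dot x f w ≠ 0 ↔
      ∃ j, k ≤ j ∧ j ≤ l2 ∧ ∀ p : Fin n, w p ∈ J ↔ ((p : ℕ) = j ∨ l2 < (p : ℕ)) := by
  have hmem : ∀ p, w p ∈ J ↔ ((x⁻¹ * w) p : ℕ) < l1 := by
    intro p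
    rw [← hx.1]
    simp
  have hdot : dot x f w ≠ 0 ↔ f (x⁻¹ * w) ≠ 0 :=
    (map_ne_zero_iff (rename (R := ℂ) x) (rename_injective _ x.injective))
  simp only [hmem]
  rw [hdot]
  constructor
  · intro hf
    obtain ⟨j, hkj, hj, y, hy, hw⟩ := not_not.1 (mt (hfzero _) hf)
    refine ⟨j, hkj, hj, (youngTwo_mul_inv_iff hl1 hsum hj (hv j hj) _).1 ?_⟩
    simpa [hw] using hy
  · rintro ⟨j, hkj, hj, hp⟩
    have hy := (youngTwo_mul_inv_iff hl1 hsum hj (hv j hj) _).2 hp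
    have hval := hfval j hkj hj _ hy
    rw [inv_mul_cancel_right] at hval
    rw [hval]
    exact prod_X_sub_X_ne_zero h _ _

/-- Two sets carried back by `w` to the same positions coincide. -/
lemma eq_of_forall_apply_mem_iff {α : Type*} {w : Equiv.Perm α} {I J : Finset α} {P : α → Prop}
    (hI : ∀ p, w p ∈ I ↔ P p) (hJ : ∀ p, w p ∈ J ↔ P p) : I = J := by
  ext a
  simpa using (hI (w.symm a)).trans (hJ (w.symm a)).symm

lemma card_inter_of_apply_mem_iff {n l2 i j : ℕ} {w : Equiv.Perm (Fin n)} {I J : Finset (Fin n)}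
    (hi : i ≤ l2) (hin : i < n) (hij : i ≠ j)
    (hI : ∀ p : Fin n, w p ∈ I ↔ ((p : ℕ) = i ∨ l2 < (p : ℕ)))
    (hJ : ∀ p : Fin n, w p ∈ J ↔ ((p : ℕ) = j ∨ l2 < (p : ℕ))) :
    (I ∩ J).card = I.card - 1 := by
  have hwi : w ⟨i, hin⟩ ∈ I := (hI _).2 (Or.inl rfl)
  rw [← Finset.card_erase_of_mem hwi]
  congr 1
  ext a
  obtain ⟨p, rfl⟩ := w.surjective a
  simp only [Finset.mem_inter, Finset.mem_erase, ne_eq, w.injective.eq_iff, hI, hJ, Fin.ext_iff]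
  omega

/-- If `|I ∩ J| = |I| - 1`, a permutation carrying `{k} ∪ {l2 + 1, …}` onto `I` can be corrected
to one which also carries `{l2} ∪ {l2 + 1, …}` onto `J`. -/
lemma exists_perm_apply_mem_iff {n l2 k : ℕ} (hk : k < l2) (hl2 : l2 < n)
    {I J : Finset (Fin n)} (hcard : I.card = J.card) (hpos : 0 < I.card)
    (hIJ : (I ∩ J).card = I.card - 1) {w : Equiv.Perm (Fin n)}
    (hw : ∀ p : Fin n, w p ∈ I ↔ ((p : ℕ) = k ∨ l2 < (p : ℕ))) :
    ∃ u : Equiv.Perm (Fin n), (∀ p : Fin n, u p ∈ I ↔ ((p : ℕ) = k ∨ l2 < (p : ℕ))) ∧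
      ∀ p : Fin n, u p ∈ J ↔ ((p : ℕ) = l2 ∨ l2 < (p : ℕ)) := by
  have h1 := Finset.card_sdiff_add_card_inter I J
  have h2 := Finset.card_sdiff_add_card_inter J I
  rw [Finset.inter_comm] at h2
  obtain ⟨a, ha⟩ := Finset.card_eq_one.1 (show (I \ J).card = 1 by omega)
  obtain ⟨b, hb⟩ := Finset.card_eq_one.1 (show (J \ I).card = 1 by omega)
  simp only [Finset.ext_iff, Finset.mem_sdiff, Finset.mem_singleton] at ha hb
  obtain ⟨haI, haJ⟩ := (ha a).2 rfl
  obtain ⟨hbJ, hbI⟩ := (hb b).2 rfl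
  set c := w ⟨k, hk.trans hl2⟩ with hc
  set d := w ⟨l2, hl2⟩ with hd
  have hcI : c ∈ I := (hw _).2 (Or.inl rfl)
  have hdI : d ∉ I := fun hm => by
    have := (hw _).1 hm
    simp only at this
    omega
  let s : Equiv.Perm (Fin n) := Equiv.swap c a * Equiv.swap d b
  have hs : ∀ x, s x ∈ I ↔ x ∈ I := by
    intro x
    simp only [s, Equiv.Perm.mul_apply, Equiv.swap_apply_def]
    grind
  have hsc : s c = a := by
    simp only [s, Equiv.Perm.mul_apply, Equiv.swap_apply_def]
    grind
  have hsd : s d = b := by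
    simp only [s, Equiv.Perm.mul_apply, Equiv.swap_apply_def]
    grind
  have hI : ∀ p : Fin n, (s * w) p ∈ I ↔ ((p : ℕ) = k ∨ l2 < (p : ℕ)) := fun p =>
    (hs (w p)).trans (hw p)
  refine ⟨s * w, hI, fun p => ?_⟩
  have hpk : (s * w) p = a ↔ (p : ℕ) = k := by
    rw [← hsc, Equiv.Perm.mul_apply, s.injective.eq_iff, hc, w.injective.eq_iff, Fin.ext_iff]
  have hpl : (s * w) p = b ↔ (p : ℕ) = l2 := by
    rw [← hsd, Equiv.Perm.mul_apply, s.injective.eq_iff, hd, w.injective.eq_iff, Fin.ext_iff]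
  have hap := ha ((s * w) p)
  have hbp := hb ((s * w) p)
  have hIp := hI p
  rw [hpk] at hap
  rw [hpl] at hbp
  by_cases hpJ : (s * w) p ∈ J <;> by_cases hpI : (s * w) p ∈ I <;>
    simp only [hpJ, hpI, not_true, not_false_eq_true, and_true, and_false,
      true_iff, false_iff] at hap hbp hIp ⊢ <;> omega

/-- Proposition 5.2 / `prop.support`: intersection pattern of the supports
of the classes `v_J · f_λ^{(λ₂ - 1)}`. -/
theorem statement10 (n : ℕ) (h : Fin n → Fin n) (hmono : Monotone h) (hgrow : ∀ i, i ≤ h i)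
    (l1 l2 k : ℕ) (hl1 : 0 < l1) (hl2 : 0 < l2) (hsum : l1 + l2 = n) (hk : k + 1 = l2)
    (v : ℕ → Equiv.Perm (Fin n)) (hv : ∀ j ≤ l2, IsVk l1 l2 j (v j))
    (f : Equiv.Perm (Fin n) → MvPolynomial (Fin n) ℂ)
    (hfval : ∀ j, k ≤ j → j ≤ l2 → ∀ y : Equiv.Perm (Fin n), YoungTwo l1 y →
      f (y * v j) = ∏ p ∈ SkSet h (v k), (X (y p.1) - X (y p.2)))
    (hfzero : ∀ w : Equiv.Perm (Fin n),
      (¬ ∃ j, k ≤ j ∧ j ≤ l2 ∧ ∃ y : Equiv.Perm (Fin n), YoungTwo l1 y ∧ w = y * v j) →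
      f w = 0)
    (vJ : Finset (Fin n) → Equiv.Perm (Fin n))
    (hvJ : ∀ J : Finset (Fin n), J.card = l1 → IsVJ l1 J (vJ J)) :
    (∀ I J : Finset (Fin n), I.card = l1 → J.card = l1 →
      (({w : Equiv.Perm (Fin n) | dot (vJ J) f w ≠ 0} ∩
          {w : Equiv.Perm (Fin n) | dot (vJ I) f w ≠ 0}).Nonempty ↔
        (I = J ∨ (I ∩ J).card = l1 - 1))) ∧
    (∀ I J K : Finset (Fin n), I.card = l1 → J.card = l1 → K.card = l1 →
      I ≠ J → I ≠ K → J ≠ K →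
      {w : Equiv.Perm (Fin n) | dot (vJ J) f w ≠ 0} ∩
        {w : Equiv.Perm (Fin n) | dot (vJ I) f w ≠ 0} ∩
        {w : Equiv.Perm (Fin n) | dot (vJ K) f w ≠ 0} = ∅) := by
  have key : ∀ J : Finset (Fin n), J.card = l1 → ∀ w, dot (vJ J) f w ≠ 0 ↔
      ∃ j, k ≤ j ∧ j ≤ l2 ∧ ∀ p : Fin n, w p ∈ J ↔ ((p : ℕ) = j ∨ l2 < (p : ℕ)) :=
    fun J hJ w => dot_ne_zero_iff h hl1 hsum hv hfval hfzero (hvJ J hJ) w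
  have base : ∀ J : Finset (Fin n), J.card = l1 → ∀ j ≤ l2,
      ∀ p : Fin n, (vJ J * v j) p ∈ J ↔ ((p : ℕ) = j ∨ l2 < (p : ℕ)) := by
    intro J hJ j hj p
    rw [Equiv.Perm.mul_apply, (hvJ J hJ).1]
    exact (youngTwo_mul_inv_iff hl1 hsum hj (hv j hj) (v j)).1 (by simp [YoungTwo]) p
  refine ⟨fun I J hI hJ => ⟨?_, ?_⟩, fun I J K hI hJ hK hIJ hIK hJK => ?_⟩
  · rintro ⟨w, hwJ, hwI⟩
    obtain ⟨j, hkj, hj, hwJ⟩ := (key J hJ w).1 hwJ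
    obtain ⟨i, hki, hi, hwI⟩ := (key I hI w).1 hwI
    by_cases hij : i = j
    · subst hij
      exact Or.inl (eq_of_forall_apply_mem_iff hwI hwJ)
    · right
      rw [card_inter_of_apply_mem_iff hi (by omega) hij hwI hwJ, hI]
  · rintro (rfl | hcard)
    · have hne := (key I hI (vJ I * v l2)).2 ⟨l2, by omega, le_rfl, base I hI l2 le_rfl⟩
      exact ⟨_, hne, hne⟩
    · obtain ⟨u, huI, huJ⟩ := exists_perm_apply_mem_iff (l2 := l2) (k := k) (by omega) (by omega)
        (hI.trans hJ.symm) (hI ▸ hl1) (hI.symm ▸ hcard) (base I hI k (by omega))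
      exact ⟨u, (key J hJ u).2 ⟨l2, by omega, le_rfl, huJ⟩,
        (key I hI u).2 ⟨k, le_rfl, by omega, huI⟩⟩
  · refine Set.eq_empty_iff_forall_notMem.2 ?_
    rintro w ⟨⟨hwJ, hwI⟩, hwK⟩
    obtain ⟨j, hkj, hj, hwJ⟩ := (key J hJ w).1 hwJ
    obtain ⟨i, hki, hi, hwI⟩ := (key I hI w).1 hwI
    obtain ⟨m, hkm, hm, hwK⟩ := (key K hK w).1 hwK
    have hij : i ≠ j := fun e => hIJ (eq_of_forall_apply_mem_iff hwI (e ▸ hwJ))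
    have him : i ≠ m := fun e => hIK (eq_of_forall_apply_mem_iff hwI (e ▸ hwK))
    have hjm : j ≠ m := fun e => hJK (eq_of_forall_apply_mem_iff hwJ (e ▸ hwK))
    omega
end
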